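/- Let Λ = {Λ_ω ∈ B(H,E) : ω ∈ Ω} and Θ = {Θ_ω ∈ B(H,E) : ω ∈ Ω} be strongly disjoint continuous g-frames for H with respect to E, let L₁, L₂ ∈ B(H) with L₁ surjective, and let L₁† ∈ B(H) be a bounded right inverse of L₁ (L₁ L₁† = I). Then {Λ_ω S_Λ⁻¹ L₁† : ω ∈ Ω} is a dual of both {Λ_ω L₁* : ω ∈ Ω} and {Λ_ω L₁* + Θ_ω L₂* : ω ∈ Ω}; in particular, for all h, k ∈ H: ∫_Ω ⟨(Λ_ω L₁* + Θ_ω L₂*)h, Λ_ω S_Λ⁻¹ L₁† k⟩ dμ(ω) = ⟨h, k⟩ and ∫_Ω ⟨Λ_ω L₁* h, Λ_ω S_Λ⁻¹ L₁† k⟩ dμ(ω) = ⟨h, k⟩. -/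

import Mathlib

open MeasureTheory
open scoped ENNReal NNReal Pointwise

noncomputable section

local notation "⟪" x ", " y "⟫" => @inner ℂ _ _ x y

variable {Ω : Type*} [MeasurableSpace Ω]

section Defs

variable {F G E : Type*}
  [NormedAddCommGroup F] [InnerProductSpace ℂ F]
  [NormedAddCommGroup G] [InnerProductSpace ℂ G]
  [NormedAddCommGroup E] [InnerProductSpace ℂ E]

/-- `Λ` is a continuous g-frame for `F` with respect to `E`, with frame bounds `A`, `B`:
for every `f`, `ω ↦ Λ ω f` is strongly measurable and
`A‖f‖² ≤ ∫ ‖Λ ω f‖² dμ(ω) ≤ B‖f‖²`. -/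
def IsCgFrame (μ : Measure Ω) (Λ : Ω → F →L[ℂ] E) (A B : ℝ) : Prop :=
  (∀ f : F, StronglyMeasurable fun ω => Λ ω f) ∧
    ∀ f : F,
      ENNReal.ofReal (A * ‖f‖ ^ 2) ≤ ∫⁻ ω, (‖Λ ω f‖₊ : ℝ≥0∞) ^ 2 ∂μ ∧
        ∫⁻ ω, (‖Λ ω f‖₊ : ℝ≥0∞) ^ 2 ∂μ ≤ ENNReal.ofReal (B * ‖f‖ ^ 2)

/-- `Λ` is a continuous g-Bessel family with Bessel constant `B`. -/
def IsCgBessel (μ : Measure Ω) (Λ : Ω → F →L[ℂ] E) (B : ℝ) : Prop :=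
  (∀ f : F, StronglyMeasurable fun ω => Λ ω f) ∧
    ∀ f : F, ∫⁻ ω, (‖Λ ω f‖₊ : ℝ≥0∞) ^ 2 ∂μ ≤ ENNReal.ofReal (B * ‖f‖ ^ 2)

/-- `Λ` is a tight continuous g-frame with bound `A`. -/
def IsCgTight (μ : Measure Ω) (Λ : Ω → F →L[ℂ] E) (A : ℝ) : Prop :=
  (∀ f : F, StronglyMeasurable fun ω => Λ ω f) ∧
    ∀ f : F, ∫⁻ ω, (‖Λ ω f‖₊ : ℝ≥0∞) ^ 2 ∂μ = ENNReal.ofReal (A * ‖f‖ ^ 2)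

/-- `Λ` is a Parseval continuous g-frame. -/
def IsCgParseval (μ : Measure Ω) (Λ : Ω → F →L[ℂ] E) : Prop :=
  (∀ f : F, StronglyMeasurable fun ω => Λ ω f) ∧
    ∀ f : F, ∫⁻ ω, (‖Λ ω f‖₊ : ℝ≥0∞) ^ 2 ∂μ = ENNReal.ofReal (‖f‖ ^ 2)

/-- The range of the analysis operator `T*_Λ : F → Ê = L²(Ω,μ;E)`, i.e. the set of elements of
`L²(Ω,μ;E)` represented by `ω ↦ Λ ω f` for some `f : F`. -/
def analysisRange (μ : Measure Ω) (Λ : Ω → F →L[ℂ] E) : Set (Lp E 2 μ) :=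
  {φ | ∃ f : F, (fun ω => Λ ω f) =ᵐ[μ] (φ : Ω → E)}

/-- `Λ` and `Θ` are strongly disjoint: the ranges of their analysis operators are orthogonal,
equivalently `∫ ⟨Λ ω h, Θ ω k⟩ dμ(ω) = 0` for all `h`, `k`. -/
def StronglyDisjoint (μ : Measure Ω) (Λ : Ω → F →L[ℂ] E) (Θ : Ω → G →L[ℂ] E) : Prop :=
  ∀ (h : F) (k : G), ∫ ω, ⟪Λ ω h, Θ ω k⟫ ∂μ = 0

/-- `Λ` and `Θ` are disjoint: `Range T*_Λ ∩ Range T*_Θ = {0}` and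
`Range T*_Λ + Range T*_Θ` is closed in `Ê`. -/
def IsDisjoint (μ : Measure Ω) (Λ : Ω → F →L[ℂ] E) (Θ : Ω → G →L[ℂ] E) : Prop :=
  analysisRange μ Λ ∩ analysisRange μ Θ = {(0 : Lp E 2 μ)} ∧
    IsClosed (analysisRange μ Λ + analysisRange μ Θ)

/-- `Λ` and `Θ` are weakly disjoint: `Range T*_Λ ∩ Range T*_Θ = {0}`. -/
def WeaklyDisjoint (μ : Measure Ω) (Λ : Ω → F →L[ℂ] E) (Θ : Ω → G →L[ℂ] E) : Prop :=
  analysisRange μ Λ ∩ analysisRange μ Θ = {(0 : Lp E 2 μ)}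

/-- `Λ` and `Θ` are a complementary pair: `Range T*_Λ ∩ Range T*_Θ = {0}` and
`Range T*_Λ + Range T*_Θ = Ê`. -/
def ComplementaryPair (μ : Measure Ω) (Λ : Ω → F →L[ℂ] E) (Θ : Ω → G →L[ℂ] E) : Prop :=
  analysisRange μ Λ ∩ analysisRange μ Θ = {(0 : Lp E 2 μ)} ∧
    analysisRange μ Λ + analysisRange μ Θ = (Set.univ : Set (Lp E 2 μ))

/-- `Λ` and `Θ` are a strongly complementary pair: `Ê` is the orthogonal direct sum of
`Range T*_Λ` and `Range T*_Θ`. -/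
def StronglyComplementaryPair (μ : Measure Ω) (Λ : Ω → F →L[ℂ] E) (Θ : Ω → G →L[ℂ] E) : Prop :=
  StronglyDisjoint μ Λ Θ ∧
    analysisRange μ Λ + analysisRange μ Θ = (Set.univ : Set (Lp E 2 μ))

/-- `S` is the (continuous g-)frame operator of `Λ`:
`⟨S f, g⟩ = ∫ ⟨Λ ω f, Λ ω g⟩ dμ(ω)`. -/
def IsFrameOperator (μ : Measure Ω) (Λ : Ω → F →L[ℂ] E) (S : F →L[ℂ] F) : Prop :=
  ∀ f g : F, ⟪S f, g⟫ = ∫ ω, ⟪Λ ω f, Λ ω g⟫ ∂μ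

/-- `Θ` is a dual of `Λ`: `∫ ⟨Θ ω f, Λ ω g⟩ dμ(ω) = ⟨f, g⟩` for all `f`, `g`. -/
def IsDualOf (μ : Measure Ω) (Θ Λ : Ω → F →L[ℂ] E) : Prop :=
  ∀ f g : F, ∫ ω, ⟪Θ ω f, Λ ω g⟫ ∂μ = ⟪f, g⟫

/-- `Λ` is a Riesz-type continuous g-frame: it is a continuous g-frame and every dual of `Λ`
is weakly equal to the canonical dual `{Λ_ω S_Λ⁻¹}`, where `S_Λ` is the frame operator. -/
def IsRieszType (μ : Measure Ω) (Λ : Ω → F →L[ℂ] E) : Prop :=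
  (∃ A B : ℝ, 0 < A ∧ IsCgFrame μ Λ A B) ∧
    ∀ S : F ≃L[ℂ] F, IsFrameOperator μ Λ (S : F →L[ℂ] F) →
      ∀ Θ : Ω → F →L[ℂ] E, (∃ A B : ℝ, 0 < A ∧ IsCgFrame μ Θ A B) → IsDualOf μ Θ Λ →
        ∀ f : F, ∀ᵐ ω ∂μ, Θ ω f = Λ ω (S.symm f)

/-- The operator `h ⊕ k ↦ Λω h + Θω k` on the Hilbert direct sum `F ⊕ G = WithLp 2 (F × G)`. -/
def pairMap (Λω : F →L[ℂ] E) (Θω : G →L[ℂ] E) : WithLp 2 (F × G) →L[ℂ] E :=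
  (Λω.comp (ContinuousLinearMap.fst ℂ F G) + Θω.comp (ContinuousLinearMap.snd ℂ F G)).comp
    (WithLp.prodContinuousLinearEquiv 2 ℂ F G).toContinuousLinearMap

end Defs

section FrameLemmas

variable {F E : Type*}
  [NormedAddCommGroup F] [InnerProductSpace ℂ F]
  [NormedAddCommGroup E] [InnerProductSpace ℂ E]

theorem IsCgFrame.memLp {μ : Measure Ω} {Λ : Ω → F →L[ℂ] E} {A B : ℝ}
    (hΛ : IsCgFrame μ Λ A B) (f : F) : MemLp (fun ω => Λ ω f) 2 μ := by
  refine ⟨(hΛ.1 f).aestronglyMeasurable, ?_⟩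
  rw [eLpNorm_lt_top_iff_lintegral_rpow_enorm_lt_top two_ne_zero ENNReal.ofNat_ne_top]
  have h := (hΛ.2 f).2.trans_lt ENNReal.ofReal_lt_top
  simpa [enorm_eq_nnnorm] using h

theorem integral_inner_conj_symm (μ : Measure Ω) (u v : Ω → E) :
    ∫ ω, ⟪u ω, v ω⟫ ∂μ = starRingEnd ℂ (∫ ω, ⟪v ω, u ω⟫ ∂μ) := by
  simp [← integral_conj]

theorem MemLp.integrable_inner_complex {μ : Measure Ω} {u v : Ω → E}
    (hu : MemLp u 2 μ) (hv : MemLp v 2 μ) : Integrable (fun ω => ⟪u ω, v ω⟫) μ := by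
  refine (L2.integrable_inner (𝕜 := ℂ) (hu.toLp u) (hv.toLp v)).congr ?_
  filter_upwards [hu.coeFn_toLp, hv.coeFn_toLp] with ω h₁ h₂
  rw [h₁, h₂]

theorem IsFrameOperator.integral_inner_symm_apply {μ : Measure Ω} {Λ : Ω → F →L[ℂ] E}
    {S : F ≃L[ℂ] F} (hS : IsFrameOperator μ Λ (S : F →L[ℂ] F)) (f g : F) :
    ∫ ω, ⟪Λ ω f, Λ ω (S.symm g)⟫ ∂μ = ⟪f, g⟫ := by
  rw [integral_inner_conj_symm, ← hS]
  simp

end FrameLemmas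

variable {H K E : Type*}
  [NormedAddCommGroup H] [InnerProductSpace ℂ H] [CompleteSpace H]
  [NormedAddCommGroup K] [InnerProductSpace ℂ K] [CompleteSpace K]
  [NormedAddCommGroup E] [InnerProductSpace ℂ E] [CompleteSpace E]

/-- if `Λ`, `Θ` are strongly disjoint continuous g-frames, `L₁` surjective with
bounded right inverse `L₁†`, then `{Λ_ω S_Λ⁻¹ L₁†}` is a dual of both `{Λ_ω L₁*}` and
`{Λ_ω L₁* + Θ_ω L₂*}`. -/
theorem stmt12 (μ : Measure Ω) (Λ Θ : Ω → H →L[ℂ] E)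
    (AL BL AT BT : ℝ) (hAL : 0 < AL) (hAT : 0 < AT)
    (hL : IsCgFrame μ Λ AL BL) (hT : IsCgFrame μ Θ AT BT)
    (hdis : StronglyDisjoint μ Λ Θ)
    (S : H ≃L[ℂ] H) (hS : IsFrameOperator μ Λ (S : H →L[ℂ] H))
    (L₁ L₂ : H →L[ℂ] H) (hL₁ : Function.Surjective ⇑L₁)
    (L₁dag : H →L[ℂ] H) (hdag : L₁.comp L₁dag = ContinuousLinearMap.id ℂ H) :
    ∀ h k : H,
      (∫ ω, ⟪Λ ω (ContinuousLinearMap.adjoint L₁ h) + Θ ω (ContinuousLinearMap.adjoint L₂ h),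
          Λ ω (S.symm (L₁dag k))⟫ ∂μ = ⟪h, k⟫) ∧
      (∫ ω, ⟪Λ ω (ContinuousLinearMap.adjoint L₁ h),
          Λ ω (S.symm (L₁dag k))⟫ ∂μ = ⟪h, k⟫) := by
  intro h k
  have key : ∫ ω, ⟪Λ ω (ContinuousLinearMap.adjoint L₁ h), Λ ω (S.symm (L₁dag k))⟫ ∂μ
      = ⟪h, k⟫ := by
    rw [hS.integral_inner_symm_apply, ContinuousLinearMap.adjoint_inner_left,
      ← ContinuousLinearMap.comp_apply, hdag, ContinuousLinearMap.id_apply]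
  refine ⟨?_, key⟩
  simp_rw [inner_add_left]
  rw [integral_add (MemLp.integrable_inner_complex (hL.memLp _) (hL.memLp _))
      (MemLp.integrable_inner_complex (hT.memLp _) (hL.memLp _)), key,
    integral_inner_conj_symm μ (fun ω => Θ ω _), hdis, map_zero, add_zero]
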